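/- There is an absolute constant C > 0 with the following property. Let h ≥ 1, Δ ≥ 1/h, and let P = P₀ \ ⋃_{i=1}^h interior(Pᵢ) be a polygonal domain in 𝒞(h) in which every hole satisfies diam₂(Pᵢ) ≤ Δ·diam₂(P). Then for every point s ∈ P there exists a continuous path γ : [0,1] → ℝ² with γ(0) = s, γ(1) ∈ frontier(P₀), image of γ contained in P, and length at most C·h^{1/2}·Δ^{1/2}·diam₂(P). -/

import Mathlib

open Set Metric ENNReal RealInnerProductSpace

noncomputable section

/-- The Euclidean plane. -/
abbrev Plane := EuclideanSpace ℝ (Fin 2)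

/-- A convex polygon: the convex hull of a nonempty finite point set. -/
def IsConvexPolygon (Q : Set Plane) : Prop :=
  ∃ S : Finset Plane, S.Nonempty ∧ Q = convexHull ℝ (S : Set Plane)

/-- `γ` is a continuous path from `s` to `t` (parametrized on `[0,1]`) with image in `P`. -/
def IsPathIn (P : Set Plane) (γ : ℝ → Plane) (s t : Plane) : Prop :=
  ContinuousOn γ (Set.Icc 0 1) ∧ γ 0 = s ∧ γ 1 = t ∧ Set.MapsTo γ (Set.Icc 0 1) P

/-- Length of a path: its total variation on `[0,1]`. -/
def pathLen (γ : ℝ → Plane) : ℝ≥0∞ := eVariationOn γ (Set.Icc 0 1)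

/-- Geodesic distance inside `P`: infimum of lengths of continuous paths
from `s` to `t` contained in `P`. -/
def geod (P : Set Plane) (s t : Plane) : ℝ≥0∞ :=
  ⨅ γ : {γ : ℝ → Plane // IsPathIn P γ s t}, pathLen γ.1

/-- Geodesic diameter of `P`. -/
def geodDiam (P : Set Plane) : ℝ≥0∞ :=
  ⨆ s ∈ P, ⨆ t ∈ P, geod P s t

/-- The width of a planar set: the minimum, over unit directions `v`,
of the extent of `C` in direction `v`. -/
def setWidth (C : Set Plane) : ℝ :=
  ⨅ v : {v : Plane // ‖v‖ = 1},
    (sSup ((fun x => ⟪x, v.1⟫) '' C) - sInf ((fun x => ⟪x, v.1⟫) '' C))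

/-- The points `s` and `t` are joined inside `P` by a curve parametrized on `[0, L]` with speed at
most one. -/
def JoinedBy (P : Set Plane) (s t : Plane) (L : ℝ) : Prop :=
  0 ≤ L ∧ ∃ γ : ℝ → Plane,
    LipschitzOnWith 1 γ (Icc 0 L) ∧ γ 0 = s ∧ γ L = t ∧ MapsTo γ (Icc 0 L) P

namespace JoinedBy

variable {P R : Set Plane} {s t r : Plane} {L M : ℝ}

theorem mem_left (h : JoinedBy P s t L) : s ∈ P := by
  obtain ⟨hL, γ, -, h0, -, hP⟩ := h
  exact h0 ▸ hP ⟨le_rfl, hL⟩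

theorem mem_right (h : JoinedBy P s t L) : t ∈ P := by
  obtain ⟨hL, γ, -, -, h1, hP⟩ := h
  exact h1 ▸ hP ⟨hL, le_rfl⟩

theorem mono_set (h : JoinedBy P s t L) (hPR : P ⊆ R) : JoinedBy R s t L := by
  obtain ⟨hL, γ, hγ, h0, h1, hP⟩ := h
  exact ⟨hL, γ, hγ, h0, h1, hP.mono_right hPR⟩

theorem mono_length (h : JoinedBy P s t L) (hLM : L ≤ M) : JoinedBy P s t M := by
  obtain ⟨hL, γ, hγ, h0, h1, hP⟩ := h
  have hmap : MapsTo (fun x => min x L) (Icc 0 M) (Icc 0 L) :=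
    fun x hx => ⟨le_min hx.1 hL, min_le_right _ _⟩
  refine ⟨hL.trans hLM, fun x => γ (min x L), ?_, by simp [hL, h0], by simp [hLM, h1],
    fun x hx => hP (hmap hx)⟩
  refine LipschitzOnWith.of_dist_le_mul fun x hx y hy => ?_
  refine (hγ.dist_le_mul _ (hmap hx) _ (hmap hy)).trans ?_
  gcongr
  rw [Real.dist_eq, Real.dist_eq]
  simpa using abs_min_sub_min_le_max x L y L

theorem trans (h₁ : JoinedBy P s t L) (h₂ : JoinedBy P t r M) : JoinedBy P s r (L + M) := by
  obtain ⟨hL, γ, hγ, h0, h1, hP⟩ := h₁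
  obtain ⟨hM, δ, hδ, k0, k1, kP⟩ := h₂
  refine ⟨by positivity, fun x => if x ≤ L then γ x else δ (x - L), ?_, by simp [hL, h0], ?_, ?_⟩
  · have key : ∀ x ∈ Icc 0 (L + M), ∀ y ∈ Icc 0 (L + M), x ≤ y →
        dist (if x ≤ L then γ x else δ (x - L)) (if y ≤ L then γ y else δ (y - L)) ≤ y - x := by
      intro x hx y hy hxy
      have hγ' : ∀ a ∈ Icc 0 L, ∀ b ∈ Icc 0 L, a ≤ b → dist (γ a) (γ b) ≤ b - a := by
        intro a ha b hb hab
        have := hγ.dist_le_mul a ha b hb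
        rwa [Real.dist_eq, abs_sub_comm, abs_of_nonneg (sub_nonneg.2 hab), NNReal.coe_one,
          one_mul] at this
      have hδ' : ∀ a ∈ Icc 0 M, ∀ b ∈ Icc 0 M, a ≤ b → dist (δ a) (δ b) ≤ b - a := by
        intro a ha b hb hab
        have := hδ.dist_le_mul a ha b hb
        rwa [Real.dist_eq, abs_sub_comm, abs_of_nonneg (sub_nonneg.2 hab), NNReal.coe_one,
          one_mul] at this
      simp only [mem_Icc] at hx hy hγ' hδ'
      split_ifs with hxL hyL hyL
      · exact hγ' x ⟨hx.1, hxL⟩ y ⟨hy.1, hyL⟩ hxy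
      · push Not at hyL
        have e₁ := hγ' x ⟨hx.1, hxL⟩ L ⟨hL, le_rfl⟩ hxL
        have e₂ := hδ' 0 ⟨le_rfl, hM⟩ (y - L) ⟨by linarith, by linarith⟩ (by linarith)
        rw [h1] at e₁
        rw [k0] at e₂
        linarith [dist_triangle (γ x) t (δ (y - L))]
      · exact absurd (hxy.trans hyL) hxL
      · push Not at hxL hyL
        have := hδ' (x - L) ⟨by linarith, by linarith⟩ (y - L) ⟨by linarith, by linarith⟩
          (by linarith)
        linarith
    refine LipschitzOnWith.of_dist_le_mul fun x hx y hy => ?_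
    rw [NNReal.coe_one, one_mul, Real.dist_eq]
    rcases le_total x y with hxy | hxy
    · rw [abs_sub_comm]
      exact (key x hx y hy hxy).trans (le_abs_self _)
    · rw [dist_comm]
      exact (key y hy x hx hxy).trans (le_abs_self _)
  · by_cases h : M = 0
    · subst h
      simp [h1, ← k0, k1]
    · have : ¬ L + M ≤ L := by
        push Not
        linarith [lt_of_le_of_ne hM (Ne.symm h)]
      simp [this, k1]
  · intro x hx
    dsimp only
    split_ifs with hxL
    · exact hP ⟨hx.1, hxL⟩
    · push Not at hxL
      exact kP ⟨by linarith, by linarith [hx.2]⟩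

theorem of_segment (h : segment ℝ s t ⊆ P) : JoinedBy P s t (dist s t) := by
  refine ⟨dist_nonneg, fun x => AffineMap.lineMap s t (x / dist s t), ?_, by simp, ?_, ?_⟩
  · refine LipschitzOnWith.of_dist_le_mul fun x _ y _ => ?_
    rw [dist_lineMap_lineMap, Real.dist_eq, Real.dist_eq, ← sub_div, abs_div,
      abs_of_nonneg (dist_nonneg (x := s) (y := t)), NNReal.coe_one, one_mul]
    rcases eq_or_ne s t with rfl | hst
    · simp
    · rw [div_mul_cancel₀ _ (dist_ne_zero.2 hst)]
  · rcases eq_or_ne s t with rfl | hst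
    · simp
    · simp [div_self (dist_ne_zero.2 hst)]
  · intro x hx
    refine h ?_
    rw [segment_eq_image_lineMap]
    exact mem_image_of_mem _ ⟨div_nonneg hx.1 dist_nonneg, div_le_one_of_le₀ hx.2 dist_nonneg⟩

theorem map (h : JoinedBy P s t L) {f : Plane → Plane} (hf : LipschitzWith 1 f)
    (hfP : MapsTo f P R) : JoinedBy R (f s) (f t) L := by
  obtain ⟨hL, γ, hγ, h0, h1, hP⟩ := h
  refine ⟨hL, f ∘ γ, ?_, by simp [h0], by simp [h1], hfP.comp hP⟩
  simpa using hf.comp_lipschitzOnWith hγ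

theorem exists_path (h : JoinedBy P s t L) : ∃ γ : ℝ → Plane,
    ContinuousOn γ (Icc 0 1) ∧ γ 0 = s ∧ γ 1 = t ∧ MapsTo γ (Icc 0 1) P ∧
      pathLen γ ≤ ENNReal.ofReal L := by
  obtain ⟨hL, γ, hγ, h0, h1, hP⟩ := h
  have hmap : MapsTo (fun x => L * x) (Icc 0 1) (Icc 0 L) :=
    fun x hx => ⟨mul_nonneg hL hx.1, mul_le_of_le_one_right hL hx.2⟩
  refine ⟨γ ∘ fun x => L * x, hγ.continuousOn.comp (by fun_prop) hmap, by simp [h0], by simp [h1],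
    hP.comp hmap, ?_⟩
  refine (hγ.comp_eVariationOn_le hmap).trans ?_
  have hmono : MonotoneOn (fun x => L * x) (Icc (0 : ℝ) 1) :=
    fun x _ y _ hxy => mul_le_mul_of_nonneg_left hxy hL
  simpa using
    (hmono.eVariationOn_eq (left_mem_Icc.2 zero_le_one) (right_mem_Icc.2 zero_le_one)).le

end JoinedBy

section Projection

variable {F : Type*} [NormedAddCommGroup F] [InnerProductSpace ℝ F] {K : Set F}

/-- The metric projection onto a convex set sends the complement of the interior to the boundary. -/
theorem exists_lipschitz_projection_compl_interior (hne : K.Nonempty) (hK : IsComplete K)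
    (hconv : Convex ℝ K) :
    ∃ π : F → F, LipschitzWith 1 π ∧ (∀ z ∈ K, π z = z) ∧
      MapsTo π (interior K)ᶜ (K \ interior K) := by
  have hex : ∀ u : F, ∃ v ∈ K, ∀ w ∈ K, ⟪u - v, w - v⟫ ≤ 0 := fun u => by
    obtain ⟨v, hv, h⟩ := exists_norm_eq_iInf_of_complete_convex hne hK hconv u
    exact ⟨v, hv, (norm_eq_iInf_iff_real_inner_le_zero hconv hv).1 h⟩
  choose π hπK hπ using hex
  have hfix : ∀ z ∈ K, π z = z := fun z hz => by
    have h := hπ z z hz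
    rw [real_inner_self_nonpos, sub_eq_zero] at h
    exact h.symm
  refine ⟨π, LipschitzWith.of_dist_le_mul fun x y => ?_, hfix, fun z hz => ⟨hπK z, fun hint => ?_⟩⟩
  · rw [NNReal.coe_one, one_mul, dist_eq_norm, dist_eq_norm]
    have h₁ := hπ x (π y) (hπK y)
    have h₂ := hπ y (π x) (hπK x)
    have h₃ : ‖π x - π y‖ ^ 2 ≤ ⟪x - y, π x - π y⟫ := by
      rw [← real_inner_self_eq_norm_sq]
      simp only [inner_sub_left, inner_sub_right] at h₁ h₂ ⊢
      linarith
    have h₄ := real_inner_le_norm (x - y) (π x - π y)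
    by_contra! hlt
    nlinarith [norm_nonneg (x - y), norm_nonneg (π x - π y)]
  · have hlim : Filter.Tendsto (fun ε : ℝ => π z + ε • (z - π z)) (nhdsWithin 0 (Ioi 0))
        (nhds (π z)) := by
      have : Continuous fun ε : ℝ => π z + ε • (z - π z) := by fun_prop
      simpa using (this.tendsto 0).mono_left nhdsWithin_le_nhds
    obtain ⟨ε, hε, hpos⟩ := ((hlim.eventually (isOpen_interior.mem_nhds hint)).and
      self_mem_nhdsWithin).exists
    have h := hπ z _ (interior_subset hε)
    rw [add_sub_cancel_left, inner_smul_right] at h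
    have h' : ⟪z - π z, z - π z⟫ ≤ 0 := nonpos_of_mul_nonpos_right h hpos
    rw [real_inner_self_nonpos, sub_eq_zero] at h'
    exact hz (h' ▸ hint)

end Projection

theorem Plane.norm_le_abs_add_abs (z : Plane) : ‖z‖ ≤ |z 0| + |z 1| := by
  rw [EuclideanSpace.norm_eq, Fin.sum_univ_two, Real.norm_eq_abs, Real.norm_eq_abs]
  refine Real.sqrt_le_iff.2 ⟨by positivity, ?_⟩
  nlinarith [abs_nonneg (z 0), abs_nonneg (z 1)]

theorem Plane.abs_apply_sub_le_dist (z w : Plane) (i : Fin 2) : |z i - w i| ≤ dist z w := by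
  rw [dist_eq_norm, ← PiLp.sub_apply, ← Real.norm_eq_abs]
  exact PiLp.norm_apply_le _ i

theorem Plane.ofLp_add_smul_zero (z : Plane) (x : ℝ) :
    (z + x • (!₂[1, 0] : Plane)) 0 = z 0 + x := by
  simp

theorem Plane.ofLp_add_smul_one (z : Plane) (x : ℝ) : (z + x • (!₂[1, 0] : Plane)) 1 = z 1 := by
  simp

/-- The linear functional `(x, y) ↦ x + τ * y`. -/
def height (τ : ℝ) (z : Plane) : ℝ := z 0 + τ * z 1

theorem continuous_height (τ : ℝ) : Continuous (height τ) := by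
  unfold height
  fun_prop

theorem convex_height_le (τ c : ℝ) : Convex ℝ {z | height τ z ≤ c} := by
  refine convex_halfSpace_le ⟨fun x y => ?_, fun a x => ?_⟩ c
  · simp [height]
    ring
  · simp [height]
    ring

theorem height_sub_le {τ : ℝ} (hτ₀ : 0 ≤ τ) (hτ₁ : τ ≤ 1) (z w : Plane) :
    height τ z - height τ w ≤ 2 * dist z w := by
  have h₀ := (le_abs_self _).trans (Plane.abs_apply_sub_le_dist z w 0)
  have h₁ := (le_abs_self _).trans (Plane.abs_apply_sub_le_dist z w 1)
  have h₂ : τ * (z 1 - w 1) ≤ 1 * dist z w := by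
    refine (mul_le_mul_of_nonneg_left h₁ hτ₀).trans ?_
    gcongr
  unfold height
  linarith

section Hole

variable {Q : Set Plane}

theorem Convex.exists_height_support (hQ : Convex ℝ Q) {p : Plane} (hp : p ∉ interior Q) {δ : ℝ}
    (hδ : 0 < δ) (hpδ : p + δ • !₂[1, 0] ∈ interior Q) :
    ∃ ν, (∀ z ∈ Q, height ν p ≤ height ν z) ∧ ∀ z ∈ interior Q, height ν p < height ν z := by
  obtain ⟨f, hf⟩ := geometric_hahn_banach_point_open hQ.interior isOpen_interior hp
  have hpos : 0 < f !₂[1, 0] := by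
    have := hf _ hpδ
    rw [map_add, map_smul, smul_eq_mul] at this
    exact pos_of_mul_pos_right (by linarith) hδ.le
  have hrep : ∀ z : Plane, f z = f !₂[1, 0] * height (f !₂[0, 1] / f !₂[1, 0]) z := fun z => by
    have hz : z = z 0 • !₂[1, 0] + z 1 • !₂[0, 1] := by
      ext i
      fin_cases i <;> simp
    conv_lhs => rw [hz, map_add, map_smul, map_smul, smul_eq_mul, smul_eq_mul]
    unfold height
    field_simp
  have hint : ∀ z ∈ interior Q, height (f !₂[0, 1] / f !₂[1, 0]) p <
      height (f !₂[0, 1] / f !₂[1, 0]) z := fun z hz => by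
    have := hf z hz
    rw [hrep p, hrep z] at this
    exact lt_of_mul_lt_mul_left this hpos.le
  refine ⟨_, fun z hz => ?_, hint⟩
  have hcl : z ∈ closure (interior Q) := by
    rw [hQ.closure_interior_eq_closure_of_nonempty_interior ⟨_, hpδ⟩]
    exact subset_closure hz
  exact closure_minimal (fun w hw => (hint w hw).le)
    (isClosed_le continuous_const (continuous_height _)) hcl

theorem exists_mem_interior_vertical_shift {z : Plane} (hz : z ∈ interior Q) :
    ∃ ε : ℝ, 0 < ε ∧ z + ε • (!₂[0, 1] : Plane) ∈ Q ∧ z - ε • (!₂[0, 1] : Plane) ∈ Q := by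
  have h₁ : Filter.Tendsto (fun ε : ℝ => z + ε • (!₂[0, 1] : Plane)) (nhdsWithin 0 (Ioi 0))
      (nhds z) := by
    have : Continuous fun ε : ℝ => z + ε • (!₂[0, 1] : Plane) := by fun_prop
    simpa using (this.tendsto 0).mono_left nhdsWithin_le_nhds
  have h₂ : Filter.Tendsto (fun ε : ℝ => z - ε • (!₂[0, 1] : Plane)) (nhdsWithin 0 (Ioi 0))
      (nhds z) := by
    have : Continuous fun ε : ℝ => z - ε • (!₂[0, 1] : Plane) := by fun_prop
    simpa using (this.tendsto 0).mono_left nhdsWithin_le_nhds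
  have hQz := mem_interior_iff_mem_nhds.1 hz
  obtain ⟨ε, ⟨hε₁, hε₂⟩, hpos⟩ := (((h₁.eventually hQz).and (h₂.eventually hQz)).and
    self_mem_nhdsWithin).exists
  exact ⟨ε, hpos, hε₁, hε₂⟩

theorem lt_of_mem_interior_of_isMaxOn {q z : Plane} (hq : ∀ w ∈ Q, w 1 ≤ q 1)
    (hz : z ∈ interior Q) : z 1 < q 1 := by
  obtain ⟨ε, hε, h, -⟩ := exists_mem_interior_vertical_shift hz
  have := hq _ h
  simp at this
  linarith

theorem lt_of_mem_interior_of_isMinOn {q z : Plane} (hq : ∀ w ∈ Q, q 1 ≤ w 1)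
    (hz : z ∈ interior Q) : q 1 < z 1 := by
  obtain ⟨ε, hε, -, h⟩ := exists_mem_interior_vertical_shift hz
  have := hq _ h
  simp at this
  linarith

/-- Two points of a compact convex set are joined along its boundary by the projection of an
L-shaped path avoiding the interior. -/
theorem joinedBy_diff_interior_of_support (hQ : Convex ℝ Q) (hc : IsCompact Q) {p q : Plane}
    (hp : p ∈ Q) (hq : q ∈ Q) {τ ν : ℝ} (hτ₀ : 0 ≤ τ) (hτ₁ : τ ≤ 1)
    (hν : ∀ z ∈ interior Q, height ν p < height ν z) (hside : (ν - τ) * (q 1 - p 1) ≤ 0)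
    (hqint : ∀ z ∈ interior Q, z 1 ≠ q 1) (hpq : height τ p ≤ height τ q) :
    JoinedBy (Q \ interior Q) p q (2 * |q 1 - p 1| + (height τ q - height τ p)) := by
  obtain ⟨π, hπ, hfix, hmap⟩ := exists_lipschitz_projection_compl_interior ⟨p, hp⟩ hc.isComplete hQ
  set m : Plane := !₂[p 0 - τ * (q 1 - p 1), q 1] with hm
  have hm0 : m 0 = p 0 - τ * (q 1 - p 1) := by simp [hm]
  have hm1 : m 1 = q 1 := by simp [hm]
  have h₁ : JoinedBy (interior Q)ᶜ p m (dist p m) := by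
    refine .of_segment fun z hz hzi => (hν z hzi).not_ge ?_
    refine (convex_height_le ν (height ν p)).segment_subset (le_refl (height ν p)) ?_ hz
    simp only [mem_ofPred_eq, height, hm0, hm1]
    linarith
  have h₂ : JoinedBy (interior Q)ᶜ m q (dist m q) := by
    refine .of_segment fun z hz hzi => hqint z hzi ?_
    obtain ⟨a, b, -, -, hab, rfl⟩ := hz
    simp [hm1, ← add_mul, hab]
  have h := (h₁.trans h₂).map hπ hmap
  rw [hfix p hp, hfix q hq] at h
  refine h.mono_length (add_le_add ?_ ?_)
  · rw [dist_comm, dist_eq_norm]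
    refine (Plane.norm_le_abs_add_abs _).trans ?_
    rw [PiLp.sub_apply, PiLp.sub_apply, hm0, hm1, sub_sub_cancel_left, abs_neg, abs_mul,
      abs_of_nonneg hτ₀]
    nlinarith [abs_nonneg (q 1 - p 1)]
  · rw [dist_comm, dist_eq_norm]
    refine (Plane.norm_le_abs_add_abs _).trans ?_
    rw [PiLp.sub_apply, PiLp.sub_apply, hm0, hm1, sub_self, abs_zero, add_zero]
    unfold height at hpq ⊢
    rw [abs_of_nonneg (by linarith)]
    linarith

theorem mul_sub_le_of_support {κ τ ν p₀ p₁ q₀ q₁ r₀ r₁ b₀ b₁ : ℝ} (hκ : 0 < κ) (hντ : ν ≤ τ)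
    (hpq : p₁ ≤ q₁) (hq : p₀ + ν * p₁ ≤ q₀ + ν * q₁) (hr : p₀ + ν * p₁ ≤ r₀ + ν * r₁)
    (hb : p₀ + ν * p₁ ≤ b₀ + ν * b₁) (hrp : r₀ + (τ - κ) * r₁ ≤ p₀ + (τ - κ) * p₁)
    (hrq : r₀ + (τ - κ) * r₁ ≤ q₀ + (τ - κ) * q₁) (hrb : r₀ + (τ - κ) * r₁ ≤ b₀ + (τ - κ) * b₁)
    (hbp : b₀ + (τ + κ) * b₁ ≤ p₀ + (τ + κ) * p₁) (hbr : b₀ + (τ + κ) * b₁ ≤ r₀ + (τ + κ) * r₁) :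
    κ * (q₁ - p₁) ≤ (q₀ + τ * q₁) - (p₀ + τ * p₁) + κ * (r₁ - b₁) := by
  have hrb' : 0 ≤ κ * (r₁ - b₁) := by linarith
  rcases le_total κ (τ - ν) with h | h
  · nlinarith
  · rcases h.eq_or_lt with h | h
    · nlinarith
    have hpr : p₁ ≤ r₁ := by
      by_contra! hlt
      nlinarith
    have hbp' : b₁ ≤ p₁ := by
      by_contra! hlt
      nlinarith
    nlinarith

/-- A point of `Q` from which the ray in direction `(1, 0)` enters the interior can be
moved along the boundary to a topmost or bottommost point without losing height. The part of the
cost that is not paid for by the gain in height is the variation of the support point of `Q` between two nearby slopes. -/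
theorem exists_deflection (hQ : Convex ℝ Q) (hc : IsCompact Q) {a : Bool → Plane}
    (ha : ∀ σ, a σ ∈ Q) (htop : ∀ z ∈ Q, z 1 ≤ a true 1) (hbot : ∀ z ∈ Q, a false 1 ≤ z 1)
    {τ K : ℝ} (hτ₀ : 0 ≤ τ) (hτ₁ : τ ≤ 1) (hK : 0 < K) {r b : Plane} (hr : r ∈ Q) (hb : b ∈ Q)
    (hrmin : ∀ z ∈ Q, height (τ - K⁻¹) r ≤ height (τ - K⁻¹) z)
    (hbmin : ∀ z ∈ Q, height (τ + K⁻¹) b ≤ height (τ + K⁻¹) z) {p : Plane} (hp : p ∈ Q)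
    (hpi : p ∉ interior Q) {δ : ℝ} (hδ : 0 < δ) (hpδ : p + δ • !₂[1, 0] ∈ interior Q) :
    ∃ σ, height τ p ≤ height τ (a σ) ∧ JoinedBy (Q \ interior Q) p (a σ)
      ((2 * K + 1) * (height τ (a σ) - height τ p) + 2 * (r 1 - b 1)) := by
  obtain ⟨ν, hν, hνi⟩ := hQ.exists_height_support hpi hδ hpδ
  have hκ : 0 < K⁻¹ := inv_pos.2 hK
  have scale : ∀ x F c : ℝ, K⁻¹ * x ≤ F + K⁻¹ * c → 2 * x + F ≤ (2 * K + 1) * F + 2 * c := by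
    intro x F c h
    have := mul_le_mul_of_nonneg_left h hK.le
    rw [mul_add, ← mul_assoc, ← mul_assoc, mul_inv_cancel₀ hK.ne', one_mul, one_mul] at this
    linarith
  rcases le_total ν τ with h | h
  · have hpq := htop p hp
    have hq := hν _ (ha true)
    have hle : height τ p ≤ height τ (a true) := by
      unfold height at hq ⊢
      nlinarith
    refine ⟨true, hle, (joinedBy_diff_interior_of_support hQ hc hp (ha true) hτ₀ hτ₁ hνi
      (by nlinarith) (fun z hz => (lt_of_mem_interior_of_isMaxOn htop hz).ne) hle).mono_length ?_⟩
    rw [abs_of_nonneg (by linarith)]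
    exact scale _ _ _ (mul_sub_le_of_support hκ h hpq hq (hν r hr) (hν b hb) (hrmin p hp)
      (hrmin _ (ha true)) (hrmin b hb) (hbmin p hp) (hbmin r hr))
  · have hpq := hbot p hp
    have hq := hν _ (ha false)
    have hle : height τ p ≤ height τ (a false) := by
      unfold height at hq ⊢
      nlinarith
    refine ⟨false, hle, (joinedBy_diff_interior_of_support hQ hc hp (ha false) hτ₀ hτ₁ hνi
      (by nlinarith) (fun z hz => (lt_of_mem_interior_of_isMinOn hbot hz).ne') hle).mono_length ?_⟩
    rw [abs_of_nonpos (by linarith)]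
    refine scale _ _ _ ?_
    have hr' := hν r hr
    have hb' := hν b hb
    have h₁ := hrmin p hp
    have h₂ := hbmin _ (ha false)
    have h₃ := hrmin b hb
    have h₄ := hbmin p hp
    have h₅ := hbmin r hr
    unfold height at *
    have := mul_sub_le_of_support (κ := K⁻¹) (τ := -τ) (ν := -ν) (p₀ := p 0) (p₁ := -p 1)
      (q₀ := a false 0) (q₁ := -a false 1) (r₀ := b 0) (r₁ := -b 1) (b₀ := r 0) (b₁ := -r 1) hκ
      (by linarith) (by linarith) (by linarith) (by linarith) (by linarith) (by linarith)
      (by linarith) (by linarith) (by linarith) (by linarith)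
    linarith

end Hole

section Escape

variable {P₀ : Set Plane} {ι : Type*} [Fintype ι] {Q : ι → Set Plane}

/-- From any point of the domain, the ray in direction `(1, 0)` stays in the domain until it either
meets the outer boundary or is about to enter a hole. -/
theorem exists_joinedBy_ray (hP₀ : IsCompact P₀) (hQ : ∀ i, IsClosed (Q i)) {s : Plane}
    (hs : s ∈ P₀ \ ⋃ i, interior (Q i)) :
    ∃ T : ℝ, 0 ≤ T ∧ JoinedBy (P₀ \ ⋃ i, interior (Q i)) s (s + T • !₂[1, 0]) T ∧
      (s + T • !₂[1, 0] ∈ frontier P₀ ∨ ∃ i, s + T • !₂[1, 0] ∈ Q i ∧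
        ∃ δ : ℝ, 0 < δ ∧ s + T • !₂[1, 0] + δ • !₂[1, 0] ∈ interior (Q i)) := by
  set P := P₀ \ ⋃ i, interior (Q i)
  have hPc : IsCompact P := hP₀.diff (isOpen_iUnion fun i => isOpen_interior)
  have hnorm : ‖(!₂[1, 0] : Plane)‖ = 1 := by
    rw [EuclideanSpace.norm_eq]
    simp
  have hdist : ∀ t : ℝ, 0 ≤ t → dist s (s + t • !₂[1, 0]) = t := fun t ht => by
    rw [dist_self_add_right, norm_smul, hnorm, mul_one, Real.norm_of_nonneg ht]
  have hcont : Continuous fun t : ℝ => s + t • (!₂[1, 0] : Plane) := by fun_prop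
  set E : Set ℝ := {t | 0 ≤ t ∧ s + t • !₂[1, 0] ∉ P}
  have hEne : E.Nonempty := by
    have hd : 0 ≤ Metric.diam P + 1 := by positivity
    refine ⟨Metric.diam P + 1, hd, fun hmem => ?_⟩
    have := Metric.dist_le_diam_of_mem hPc.isBounded hs hmem
    rw [hdist _ hd] at this
    linarith
  have hEbdd : BddBelow E := ⟨0, fun t ht => ht.1⟩
  set T := sInf E
  have hT₀ : 0 ≤ T := le_csInf hEne fun t ht => ht.1
  have hbefore : ∀ t, 0 ≤ t → t < T → s + t • !₂[1, 0] ∈ P := fun t ht htT => by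
    by_contra hmem
    exact (csInf_le hEbdd ⟨ht, hmem⟩).not_gt htT
  have hTP : s + T • !₂[1, 0] ∈ P := by
    rcases hT₀.eq_or_lt with h0 | hpos
    · simpa [← h0] using hs
    · refine hPc.isClosed.mem_of_tendsto
        ((hcont.tendsto T).mono_left (nhdsWithin_le_nhds (s := Iio T))) ?_
      filter_upwards [Ioo_mem_nhdsLT hpos] with t ht
      exact hbefore t ht.1.le ht.2
  refine ⟨T, hT₀, ?_, ?_⟩
  · have hseg : JoinedBy P s (s + T • !₂[1, 0]) (dist s (s + T • !₂[1, 0])) := by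
      refine .of_segment fun z hz => ?_
      rw [segment_eq_image'] at hz
      obtain ⟨θ, hθ, rfl⟩ := hz
      simp only [add_sub_cancel_left, smul_smul]
      rcases (mul_le_of_le_one_left hT₀ hθ.2).eq_or_lt with h | h
      · rwa [h]
      · exact hbefore _ (mul_nonneg hθ.1 hT₀) h
    rwa [hdist T hT₀] at hseg
  · refine or_iff_not_imp_left.2 fun hfr => ?_
    have hint : s + T • !₂[1, 0] ∈ interior P₀ := by
      by_contra hni
      exact hfr ⟨subset_closure hTP.1, hni⟩
    have hfreq : ∃ᶠ t in nhdsWithin T (Ioi T), s + t • !₂[1, 0] ∉ P := by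
      rw [Filter.frequently_iff]
      intro U hU
      obtain ⟨u, hu, hsub⟩ := (mem_nhdsGT_iff_exists_Ioo_subset).1 hU
      obtain ⟨t, ht, htu⟩ := exists_lt_of_csInf_lt hEne hu
      refine ⟨t, hsub ⟨lt_of_le_of_ne (csInf_le hEbdd ht) ?_, htu⟩, ht.2⟩
      intro hTt
      exact ht.2 (hTt ▸ hTP)
    have hlim := (hcont.tendsto T).mono_left (nhdsWithin_le_nhds (s := Ioi T))
    have hfreq' : ∃ i, ∃ᶠ t in nhdsWithin T (Ioi T), s + t • !₂[1, 0] ∈ interior (Q i) := by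
      by_contra! hcon
      refine hfreq ?_
      filter_upwards [Filter.eventually_all.2 hcon,
        hlim.eventually (isOpen_interior.mem_nhds hint)] with t ht htP hnP
      exact hnP ⟨interior_subset htP, by simpa using ht⟩
    obtain ⟨i, hi⟩ := hfreq'
    refine ⟨i, (hQ i).mem_of_frequently_of_tendsto (hi.mono fun t ht => interior_subset ht) hlim,
      ?_⟩
    obtain ⟨t, ht, htT⟩ := (hi.and_eventually self_mem_nhdsWithin).exists
    refine ⟨t - T, sub_pos.2 htT, ?_⟩
    rwa [add_assoc, ← add_smul, add_sub_cancel]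

/-- Alternating rays and deflections reaches the outer boundary, and uses each extreme point of each
hole at most once. -/
theorem exists_joinedBy_frontier (hP₀ : IsCompact P₀) (hQ : ∀ i, IsClosed (Q i))
    (hdisj : Pairwise (Function.onFun Disjoint Q)) (hsub : ∀ i, Q i ⊆ P₀)
    {a : ι → Bool → Plane} (ha : ∀ i σ, a i σ ∈ Q i) (htop : ∀ i, ∀ z ∈ Q i, z 1 ≤ a i true 1)
    (hbot : ∀ i, ∀ z ∈ Q i, a i false 1 ≤ z 1) {τ A : ℝ} {c : ι → ℝ} (hA : 1 ≤ A)
    (hc : ∀ i, 0 ≤ c i)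
    (hdefl : ∀ i, ∀ p ∈ Q i, p ∉ interior (Q i) →
      (∃ δ : ℝ, 0 < δ ∧ p + δ • !₂[1, 0] ∈ interior (Q i)) →
      ∃ σ, height τ p ≤ height τ (a i σ) ∧ JoinedBy (Q i \ interior (Q i)) p (a i σ)
        (A * (height τ (a i σ) - height τ p) + c i))
    {s : Plane} (hs : s ∈ P₀ \ ⋃ i, interior (Q i)) :
    ∃ z ∈ frontier P₀, JoinedBy (P₀ \ ⋃ i, interior (Q i)) s z
      (A * (height τ z - height τ s) + 2 * ∑ i, c i) := by
  classical
  have hheight : ∀ (z : Plane) (T : ℝ), height τ (z + T • !₂[1, 0]) = height τ z + T :=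
    fun z T => by
      unfold height
      rw [Plane.ofLp_add_smul_zero, Plane.ofLp_add_smul_one]
      ring
  have hboundary : ∀ i, Q i \ interior (Q i) ⊆ P₀ \ ⋃ j, interior (Q j) := by
    refine fun i z hz => ⟨hsub i hz.1, fun hmem => ?_⟩
    obtain ⟨j, hj⟩ := mem_iUnion.1 hmem
    rcases eq_or_ne i j with rfl | hij
    · exact hz.2 hj
    · exact Set.disjoint_left.1 (hdisj hij) hz.1 (interior_subset hj)
  have hnext : ∀ i σ, ∀ δ : ℝ, a i σ + δ • !₂[1, 0] ∉ interior (Q i) := by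
    intro i σ δ hmem
    have h₁ := lt_of_mem_interior_of_isMaxOn (htop i) hmem
    have h₂ := lt_of_mem_interior_of_isMinOn (hbot i) hmem
    rw [Plane.ofLp_add_smul_one] at h₁ h₂
    cases σ
    · exact h₂.ne rfl
    · exact h₁.ne rfl
  set alive : Plane → Finset (ι × Bool) := fun p =>
    Finset.univ.filter fun x => height τ p ≤ height τ (a x.1 x.2) with halive
  have escape_of_hit : ∀ n : ℕ, ∀ p, (alive p).card ≤ n → p ∈ P₀ \ ⋃ i, interior (Q i) →
      ∀ i, p ∈ Q i → (∃ δ : ℝ, 0 < δ ∧ p + δ • !₂[1, 0] ∈ interior (Q i)) →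
      ∃ z ∈ frontier P₀, JoinedBy (P₀ \ ⋃ i, interior (Q i)) p z
        (A * (height τ z - height τ p) + ∑ x ∈ alive p, c x.1) := by
    intro n
    induction n with
    | zero =>
      intro p hcard hp i hpi hδ
      obtain ⟨σ, hle, -⟩ := hdefl i p hpi (fun h => hp.2 (mem_iUnion_of_mem i h)) hδ
      have hmem : (i, σ) ∈ alive p := by simpa [halive] using hle
      simp [Finset.card_eq_zero.1 (Nat.le_zero.1 hcard)] at hmem
    | succ n ih =>
      intro p hcard hp i hpi hδ
      obtain ⟨σ, hle, hjoin⟩ := hdefl i p hpi (fun h => hp.2 (mem_iUnion_of_mem i h)) hδ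
      have hmem : (i, σ) ∈ alive p := by simpa [halive] using hle
      have hjoin' := hjoin.mono_set (hboundary i)
      obtain ⟨T, hT, hray, hend⟩ := exists_joinedBy_ray hP₀ hQ hjoin'.mem_right
      have hTA : T ≤ A * T := le_mul_of_one_le_left hT hA
      have hlen := hheight (a i σ) T
      rcases hend with hfr | ⟨j, hj, hδ'⟩
      · refine ⟨_, hfr, (hjoin'.trans hray).mono_length ?_⟩
        have := Finset.single_le_sum (f := fun x : ι × Bool => c x.1) (fun x _ => hc x.1) hmem
        rw [hlen]
        linarith
      · have hTpos : 0 < T := by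
          refine lt_of_le_of_ne hT fun h0 => ?_
          rw [← h0, zero_smul, add_zero] at hj hδ'
          rcases eq_or_ne i j with rfl | hij
          · obtain ⟨δ, -, hmem⟩ := hδ'
            exact hnext i σ δ hmem
          · exact Set.disjoint_left.1 (hdisj hij) (ha i σ) hj
        set p' := a i σ + T • (!₂[1, 0] : Plane)
        have hsubset : alive p' ⊆ (alive p).erase (i, σ) := by
          intro x hx
          simp only [halive, Finset.mem_filter, Finset.mem_univ, true_and, Finset.mem_erase]
            at hx ⊢
          refine ⟨?_, by linarith⟩
          rintro rfl
          dsimp only at hx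
          linarith
        have hcard' : (alive p').card ≤ n := by
          have h₁ := Finset.card_le_card hsubset
          rw [Finset.card_erase_of_mem hmem] at h₁
          omega
        obtain ⟨z, hz, hjz⟩ := ih p' hcard' hray.mem_right j hj hδ'
        refine ⟨z, hz, ((hjoin'.trans hray).trans hjz).mono_length ?_⟩
        have h₁ := Finset.sum_le_sum_of_subset_of_nonneg (f := fun x : ι × Bool => c x.1) hsubset
          fun x _ _ => hc x.1
        have h₂ := Finset.add_sum_erase _ (fun x : ι × Bool => c x.1) hmem
        dsimp only at h₂
        rw [hlen]
        linarith
  have hsum : ∀ p, ∑ x ∈ alive p, c x.1 ≤ 2 * ∑ i, c i := fun p => by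
    refine (Finset.sum_le_sum_of_subset_of_nonneg (Finset.subset_univ _)
      fun x _ _ => hc x.1).trans ?_
    rw [Fintype.sum_prod_type, Finset.mul_sum]
    simp
  obtain ⟨T, hT, hray, hend⟩ := exists_joinedBy_ray hP₀ hQ hs
  have hTA : T ≤ A * T := le_mul_of_one_le_left hT hA
  have hlen := hheight s T
  rcases hend with hfr | ⟨i, hi, hδ⟩
  · refine ⟨_, hfr, hray.mono_length ?_⟩
    rw [hlen]
    linarith [Finset.sum_nonneg fun i (_ : i ∈ Finset.univ) => hc i]
  · obtain ⟨z, hz, hjz⟩ := escape_of_hit _ _ le_rfl hray.mem_right i hi hδ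
    refine ⟨z, hz, (hray.trans hjz).mono_length ?_⟩
    have := hsum (s + T • !₂[1, 0])
    rw [hlen]
    linarith

/-- An escape bound with a free parameter: the height functional is chosen by averaging over `N`
equally spaced slopes in `[0, 1]`. -/
theorem exists_joinedBy_frontier_of_diam_le (hP₀ : IsCompact P₀) (hQconv : ∀ i, Convex ℝ (Q i))
    (hQ : ∀ i, IsCompact (Q i)) (hQne : ∀ i, (Q i).Nonempty)
    (hdisj : Pairwise (Function.onFun Disjoint Q)) (hsub : ∀ i, Q i ⊆ interior P₀) {d : ℝ}
    (hd : ∀ i, Metric.diam (Q i) ≤ d) {N : ℕ} (hN : 1 ≤ N) {s : Plane}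
    (hs : s ∈ P₀ \ ⋃ i, interior (Q i)) :
    ∃ z ∈ frontier P₀, JoinedBy (P₀ \ ⋃ i, interior (Q i)) s z
      ((4 * N + 1) * (2 * Metric.diam (P₀ \ ⋃ i, interior (Q i))) +
        4 * (Fintype.card ι * d / N)) := by
  have hNpos : (0 : ℝ) < N := by exact_mod_cast hN
  have hcoord : Continuous fun z : Plane => z 1 := by fun_prop
  choose top htopQ htop using fun i => (hQ i).exists_isMaxOn (hQne i) hcoord.continuousOn
  choose bot hbotQ hbot using fun i => (hQ i).exists_isMinOn (hQne i) hcoord.continuousOn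
  choose r hrQ hr using fun i τ =>
    (hQ i).exists_isMinOn (hQne i) (continuous_height τ).continuousOn
  set c : ℕ → ι → ℝ := fun j i => r i (j / N) 1 - r i ((j + 1 : ℕ) / N) 1 with hc
  have hc₀ : ∀ j i, 0 ≤ c j i := fun j i => by
    have h₁ := hr i (j / N) (hrQ i ((j + 1 : ℕ) / N))
    have h₂ := hr i ((j + 1 : ℕ) / N) (hrQ i (j / N))
    simp only [mem_ofPred_eq, height] at h₁ h₂
    have h₃ : (((j + 1 : ℕ) : ℝ) / N) = j / N + 1 / N := by push_cast; ring
    have h₄ : 0 < 1 / (N : ℝ) := by positivity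
    refine nonneg_of_mul_nonneg_right (b := c j i) (a := 1 / (N : ℝ)) ?_ h₄
    simp only [hc]
    rw [h₃] at h₁ h₂ ⊢
    linarith
  have htel : ∑ j ∈ Finset.range N, ∑ i, c j i ≤ Fintype.card ι * d := by
    rw [Finset.sum_comm]
    refine (Finset.sum_le_card_nsmul _ _ d fun i _ => ?_).trans (by simp)
    rw [Finset.sum_range_sub' fun j : ℕ => r i (j / N) 1]
    exact ((le_abs_self _).trans (Plane.abs_apply_sub_le_dist _ _ 1)).trans
      ((Metric.dist_le_diam_of_mem (hQ i).isBounded (hrQ i _) (hrQ i _)).trans (hd i))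
  obtain ⟨j, hjN, hj⟩ : ∃ j ∈ Finset.range N, ∑ i, c j i ≤ Fintype.card ι * d / N := by
    refine Finset.exists_le_of_sum_le ⟨0, Finset.mem_range.2 hN⟩ (htel.trans ?_)
    rw [Finset.sum_const, Finset.card_range, nsmul_eq_mul, mul_div_cancel₀ _ hNpos.ne']
  rw [Finset.mem_range] at hjN
  set τ : ℝ := (2 * j + 1) / (2 * N) with hτ
  have hτ₀ : 0 ≤ τ := by positivity
  have hτ₁ : τ ≤ 1 := by
    rw [hτ, div_le_one (by positivity)]
    have : (j : ℝ) + 1 ≤ N := by exact_mod_cast hjN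
    linarith
  have hτm : τ - (2 * N : ℝ)⁻¹ = j / N := by
    rw [hτ]
    field_simp
    ring
  have hτp : τ + (2 * N : ℝ)⁻¹ = (j + 1 : ℕ) / N := by
    rw [hτ]
    push_cast
    field_simp
    ring
  obtain ⟨z, hz, hjoin⟩ := exists_joinedBy_frontier (τ := τ) (A := 2 * (2 * N) + 1)
    (a := fun i σ => cond σ (top i) (bot i)) (c := fun i => 2 * c j i) hP₀
    (fun i => (hQ i).isClosed) hdisj (fun i => (hsub i).trans interior_subset)
    (fun i σ => by cases σ; exacts [hbotQ i, htopQ i]) (fun i z hz => htop i hz)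
    (fun i z hz => hbot i hz) (by linarith) (fun i => mul_nonneg zero_le_two (hc₀ j i))
    (fun i p hp hpi ⟨δ, hδ, hpδ⟩ => exists_deflection (hQconv i) (hQ i)
      (a := fun σ => cond σ (top i) (bot i)) (fun σ => by cases σ; exacts [hbotQ i, htopQ i])
      (fun z hz => htop i hz) (fun z hz => hbot i hz) hτ₀ hτ₁ (by positivity) (hrQ i _) (hrQ i _)
      (hτm ▸ fun z hz => hr i _ hz) (hτp ▸ fun z hz => hr i _ hz) hp hpi hδ hpδ) hs
  refine ⟨z, hz, hjoin.mono_length (add_le_add ?_ ?_)⟩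
  · have hbdd : Bornology.IsBounded (P₀ \ ⋃ i, interior (Q i)) := hP₀.isBounded.subset sdiff_subset
    have := (height_sub_le hτ₀ hτ₁ z s).trans
      (mul_le_mul_of_nonneg_left (Metric.dist_le_diam_of_mem hbdd hjoin.mem_right hs) zero_le_two)
    have h4 : (2 * (2 * N) + 1 : ℝ) = 4 * N + 1 := by ring
    rw [h4]
    gcongr
  · rw [← Finset.mul_sum]
    linarith

end Escape

theorem IsConvexPolygon.convex {Q : Set Plane} (h : IsConvexPolygon Q) : Convex ℝ Q := by
  obtain ⟨S, -, rfl⟩ := h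
  exact convex_convexHull ℝ _

theorem IsConvexPolygon.isCompact {Q : Set Plane} (h : IsConvexPolygon Q) : IsCompact Q := by
  obtain ⟨S, -, rfl⟩ := h
  exact S.finite_toSet.isCompact_convexHull ℝ

theorem IsConvexPolygon.nonempty {Q : Set Plane} (h : IsConvexPolygon Q) : Q.Nonempty := by
  obtain ⟨S, hS, rfl⟩ := h
  exact (Finset.coe_nonempty.2 hS).convexHull

/-- There is an absolute constant `C > 0` such that for every `h ≥ 1`,
`Δ ≥ 1/h`, and every polygonal domain `P ∈ 𝒞(h)` whose holes satisfy
`diam₂(Pᵢ) ≤ Δ·diam₂(P)`, from every `s ∈ P` there is a continuous path in `P` to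
`frontier P₀` of length at most `C·h^{1/2}·Δ^{1/2}·diam₂(P)`. -/
theorem escape_path_sqrt_bound :
    ∃ C : ℝ, 0 < C ∧
      ∀ (h : ℕ), 1 ≤ h → ∀ (Δ : ℝ), 1 / (h : ℝ) ≤ Δ →
        ∀ (P₀ : Set Plane) (Q : Fin h → Set Plane),
          IsConvexPolygon P₀ →
          (∀ i, IsConvexPolygon (Q i)) →
          Pairwise (Function.onFun Disjoint Q) →
          (∀ i, Q i ⊆ interior P₀) →
          (∀ i, Metric.diam (Q i) ≤ Δ * Metric.diam (P₀ \ ⋃ j, interior (Q j))) →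
          ∀ s ∈ (P₀ \ ⋃ i, interior (Q i)),
            ∃ γ : ℝ → Plane,
              ContinuousOn γ (Set.Icc 0 1) ∧ γ 0 = s ∧ γ 1 ∈ frontier P₀ ∧
              Set.MapsTo γ (Set.Icc 0 1) (P₀ \ ⋃ i, interior (Q i)) ∧
              pathLen γ ≤
                ENNReal.ofReal
                  (C * Real.sqrt h * Real.sqrt Δ *
                    Metric.diam (P₀ \ ⋃ i, interior (Q i))) := by
  refine ⟨24, by norm_num, fun h hh Δ hΔ P₀ Q hP₀ hQ hdisj hsub hdiam s hs => ?_⟩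
  set D := Metric.diam (P₀ \ ⋃ i, interior (Q i))
  have hD : 0 ≤ D := Metric.diam_nonneg
  have hpos : (0 : ℝ) < h := by exact_mod_cast hh
  have hS : 1 ≤ h * Δ := by
    rw [div_le_iff₀ hpos] at hΔ
    linarith
  set S := Real.sqrt (h * Δ) with hSdef
  have hS₁ : 1 ≤ S := Real.one_le_sqrt.2 hS
  have hSS : S * S = h * Δ := Real.mul_self_sqrt (by linarith)
  have hceil := Nat.le_ceil S
  have hceil' := (Nat.ceil_lt_add_one (by linarith : 0 ≤ S)).le
  have hceil₁ : 1 ≤ ⌈S⌉₊ := Nat.one_le_ceil_iff.2 (by linarith)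
  obtain ⟨z, hz, hjoin⟩ := exists_joinedBy_frontier_of_diam_le hP₀.isCompact
    (fun i => (hQ i).convex) (fun i => (hQ i).isCompact) (fun i => (hQ i).nonempty) hdisj hsub
    hdiam hceil₁ hs
  have hlen : (4 * ⌈S⌉₊ + 1) * (2 * D) + 4 * (Fintype.card (Fin h) * (Δ * D) / ⌈S⌉₊) ≤
      24 * Real.sqrt h * Real.sqrt Δ * D := by
    have h₁ : Fintype.card (Fin h) * (Δ * D) / ⌈S⌉₊ ≤ S * D := by
      rw [Fintype.card_fin, div_le_iff₀ (by linarith), ← mul_assoc, ← hSS]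
      have := mul_le_mul_of_nonneg_left hceil (mul_nonneg (by linarith : 0 ≤ S) hD)
      linarith
    have h₂ : (4 * ⌈S⌉₊ + 1) * (2 * D) ≤ (10 * S) * (2 * D) := by
      gcongr
      linarith
    rw [mul_assoc 24, ← Real.sqrt_mul hpos.le, ← hSdef]
    linarith
  obtain ⟨γ, hγ, h0, h1, hP, hγlen⟩ := (hjoin.mono_length hlen).exists_path
  exact ⟨γ, hγ, h0, h1 ▸ hz, hP, hγlen⟩
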